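/- Let r > 1 be a real number that is not an integer. There exist constants C = C(r) and x_0 = x_0(r) such that for all x ≥ x_0 and every choice of integers ℓ_d with 0 ≤ ℓ_d ≤ e_2(d) − 1 for each d, one has Σ_d (1/d) · #{ k positive integer : k ≤ (log(2x)/log 2)^{1/r}, ⌊k^r⌋ ≡ ℓ_d (mod e_2(d)) } ≤ C · (log x)^{1/r}, where the outer sum is over all odd squarefree positive integers d ≤ x such that every prime factor of d is less than log x and e_2(d) ≤ (log x)^{1 − 1/r} · log log x. -/

import Mathlib

/-- The sum of the reciprocals of the primes up to `2 ^ n` grows slower than any multiple of `n`. -/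
theorem exists_sum_primesLE_two_pow_inv_le {ε : ℝ} (hε : 0 < ε) :
    ∃ C : ℝ, ∀ n : ℕ, ∑ p ∈ Nat.primesLE (2 ^ n), (1 / (p : ℝ)) ≤ C + ε * n := by
  set S : ℕ → ℝ := fun n => ∑ p ∈ Nat.primesLE (2 ^ n), (1 / (p : ℝ)) with hS
  have hmono : ∀ {a b : ℕ}, a ≤ b → Nat.primesLE a ⊆ Nat.primesLE b := fun hab p hp => by
    rw [Nat.mem_primesLE] at hp ⊢
    exact ⟨hp.1.trans hab, hp.2⟩
  have step : ∀ n : ℕ, 0 < n → S (n + 1) ≤ S n + 4 / n := by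
    intro n hn
    have hsub : Nat.primesLE (2 ^ n) ⊆ Nat.primesLE (2 ^ (n + 1)) :=
      hmono (Nat.pow_le_pow_right (by norm_num) (by omega))
    have hsplit := Finset.sum_sdiff (f := fun p : ℕ => 1 / (p : ℝ)) hsub
    have hn' : (0 : ℝ) < n := by exact_mod_cast hn
    have hlog2 : 0 < Real.log 2 := Real.log_pos (by norm_num)
    have key : ∑ p ∈ Nat.primesLE (2 ^ (n + 1)) \ Nat.primesLE (2 ^ n), (1 / (p : ℝ)) ≤ 4 / n := by
      have h1 : ∀ p ∈ Nat.primesLE (2 ^ (n + 1)) \ Nat.primesLE (2 ^ n),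
          1 / (p : ℝ) ≤ Real.log p / (2 ^ n * (n * Real.log 2)) := by
        intro p hp
        rw [Finset.mem_sdiff, Nat.mem_primesLE, Nat.mem_primesLE] at hp
        have hlt : 2 ^ n < p := by
          by_contra h
          exact hp.2 ⟨not_lt.mp h, hp.1.2⟩
        have hltR : (2 : ℝ) ^ n ≤ p := by exact_mod_cast hlt.le
        have hlog : n * Real.log 2 ≤ Real.log p := by
          rw [← Real.log_pow]
          exact Real.log_le_log (by positivity) hltR
        have hp0 : (0 : ℝ) < p := by exact_mod_cast hp.1.2.pos
        rw [div_le_div_iff₀ hp0 (by positivity), one_mul, mul_comm]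
        gcongr
      have h2 := Chebyshev.theta_le_log4_mul_x (x := ((2 ^ (n + 1) : ℕ) : ℝ)) (by positivity)
      rw [Chebyshev.theta_eq_sum_primesLE_log] at h2
      calc _ ≤ ∑ p ∈ Nat.primesLE (2 ^ (n + 1)) \ Nat.primesLE (2 ^ n),
              Real.log p / (2 ^ n * (n * Real.log 2)) := Finset.sum_le_sum h1
        _ ≤ ∑ p ∈ Nat.primesLE (2 ^ (n + 1)), Real.log p / (2 ^ n * (n * Real.log 2)) :=
            Finset.sum_le_sum_of_subset_of_nonneg Finset.sdiff_subset
              fun p _ _ => div_nonneg (Real.log_natCast_nonneg p) (by positivity)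
        _ = (∑ p ∈ Nat.primesLE (2 ^ (n + 1)), Real.log p) / (2 ^ n * (n * Real.log 2)) := by
            rw [Finset.sum_div]
        _ ≤ (Real.log 4 * ((2 ^ (n + 1) : ℕ) : ℝ)) / (2 ^ n * (n * Real.log 2)) := by gcongr
        _ = 4 / n := by
            have : Real.log 4 = 2 * Real.log 2 := by
              rw [show (4 : ℝ) = 2 ^ 2 by norm_num, Real.log_pow]; norm_num
            rw [this]
            push_cast
            field_simp
            ring
    simp only [hS]
    linarith
  obtain ⟨m, hm⟩ := exists_nat_gt (4 / ε)
  have hm0 : (0 : ℝ) < m := lt_trans (by positivity) hm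
  refine ⟨S m, fun n => ?_⟩
  change S n ≤ _
  rcases le_total n m with h | h
  · have : S n ≤ S m := Finset.sum_le_sum_of_subset_of_nonneg
      (hmono (Nat.pow_le_pow_right (by norm_num) h)) fun _ _ _ => by positivity
    have : 0 ≤ ε * n := by positivity
    linarith
  · induction n, h using Nat.le_induction with
    | base => have : 0 ≤ ε * m := by positivity
              linarith
    | succ n hmn ih =>
      have hmn' : (m : ℝ) ≤ n := by exact_mod_cast hmn
      have hn0 : (0 : ℝ) < n := hm0.trans_le hmn'
      have h1 := step n (by exact_mod_cast hn0)
      have h2 : 4 / (n : ℝ) ≤ ε := by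
        rw [div_le_iff₀ hn0]
        rw [div_lt_iff₀ hε] at hm
        nlinarith
      push_cast
      linarith

/-- A set of at most `T` primes has reciprocal sum at most that of the primes up to `T`,
up to an additive constant. -/
theorem sum_prime_inv_le_of_card_le {P : Finset ℕ} (hP : ∀ p ∈ P, p.Prime) {T : ℕ} (hT : 0 < T)
    (hcard : P.card ≤ T) :
    ∑ p ∈ P, (1 / (p : ℝ)) ≤ ∑ p ∈ Nat.primesLE T, (1 / (p : ℝ)) + 1 := by
  have hT' : (0 : ℝ) < T := by exact_mod_cast hT
  rw [← Finset.sum_filter_add_sum_filter_not P (fun p => p ≤ T)]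
  gcongr
  · intro p hp
    rw [Finset.mem_filter] at hp
    exact Nat.mem_primesLE.mpr ⟨hp.2, hP p hp.1⟩
  · calc ∑ p ∈ P with ¬ p ≤ T, (1 / (p : ℝ)) ≤ ∑ p ∈ P with ¬ p ≤ T, (1 / (T : ℝ)) := by
          refine Finset.sum_le_sum fun p hp => ?_
          rw [Finset.mem_filter, not_le] at hp
          have : (T : ℝ) ≤ p := by exact_mod_cast hp.2.le
          gcongr
      _ = (P.filter (fun p => ¬ p ≤ T)).card / (T : ℝ) := by simp [div_eq_mul_inv]
      _ ≤ T / (T : ℝ) := by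
          gcongr
          exact_mod_cast (Finset.card_filter_le _ _).trans hcard
      _ = 1 := div_self hT'.ne'

theorem card_primeFactors_two_pow_sub_one_le (m : ℕ) (hm : 0 < m) :
    (2 ^ m - 1).primeFactors.card ≤ m := by
  have h0 : 2 ^ m - 1 ≠ 0 := by
    have := Nat.one_lt_two_pow hm.ne'
    omega
  have h1 : 2 ^ (2 ^ m - 1).primeFactors.card ≤ ∏ p ∈ (2 ^ m - 1).primeFactors, p :=
    Finset.pow_card_le_prod _ _ _ fun p hp => (Nat.prime_of_mem_primeFactors hp).two_le
  have h2 := Nat.le_of_dvd (Nat.pos_of_ne_zero h0) (Nat.prod_primeFactors_dvd (2 ^ m - 1))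
  have h3 : 2 ^ (2 ^ m - 1).primeFactors.card ≤ 2 ^ m := by omega
  exact (Nat.pow_le_pow_iff_right (by norm_num)).mp h3

theorem dvd_two_pow_orderOf_sub_one (d : ℕ) : d ∣ 2 ^ orderOf (2 : ZMod d) - 1 := by
  rw [← ZMod.natCast_eq_zero_iff, Nat.cast_sub Nat.one_le_two_pow]
  push_cast
  rw [pow_orderOf_eq_one, sub_self]

theorem orderOf_two_zmod_pos {d : ℕ} (hd : Odd d) : 0 < orderOf (2 : ZMod d) := by
  have : NeZero d := ⟨hd.pos.ne'⟩
  have h : IsUnit (2 : ZMod d) := by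
    have := (ZMod.isUnit_iff_coprime 2 d).mpr (Nat.coprime_two_left.mpr hd)
    exact_mod_cast this
  obtain ⟨u, hu⟩ := h
  rw [← hu, orderOf_units]
  exact orderOf_pos u

/-- A Romanoff-type bound: the reciprocals of the odd squarefree `d` for which `2` has order at
most `2 ^ n` modulo `d` sum to at most `C * exp (ε * n)`. -/
theorem exists_sum_inv_le_exp_of_orderOf_le {ε : ℝ} (hε : 0 < ε) :
    ∃ C : ℝ, 0 < C ∧ ∀ (n : ℕ) (S : Finset ℕ),
      (∀ d ∈ S, Odd d ∧ Squarefree d ∧ orderOf (2 : ZMod d) ≤ 2 ^ n) →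
      ∑ d ∈ S, (1 / (d : ℝ)) ≤ C * Real.exp (ε * n) := by
  obtain ⟨C, hC⟩ := exists_sum_primesLE_two_pow_inv_le (half_pos hε)
  refine ⟨Real.exp (C + 1), Real.exp_pos _, fun n S hS => ?_⟩
  set P : Finset ℕ := (Finset.Icc 1 (2 ^ n)).biUnion fun m => (2 ^ m - 1).primeFactors with hP
  have hPprime : ∀ p ∈ P, p.Prime := by
    intro p hp
    rw [hP, Finset.mem_biUnion] at hp
    obtain ⟨m, -, hp⟩ := hp
    exact Nat.prime_of_mem_primeFactors hp
  have hcard : P.card ≤ 2 ^ (2 * n) := by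
    calc P.card ≤ ∑ m ∈ Finset.Icc 1 (2 ^ n), (2 ^ m - 1).primeFactors.card :=
          Finset.card_biUnion_le
      _ ≤ ∑ m ∈ Finset.Icc 1 (2 ^ n), 2 ^ n := by
          refine Finset.sum_le_sum fun m hm => ?_
          rw [Finset.mem_Icc] at hm
          exact (card_primeFactors_two_pow_sub_one_le m hm.1).trans hm.2
      _ = 2 ^ (2 * n) := by simp [two_mul, pow_add]
  have hsub : ∀ d ∈ S, d.primeFactors ∈ P.powerset := by
    intro d hd
    obtain ⟨hodd, -, hle⟩ := hS d hd
    rw [Finset.mem_powerset]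
    intro p hp
    rw [hP, Finset.mem_biUnion]
    have hpos := orderOf_two_zmod_pos hodd
    refine ⟨orderOf (2 : ZMod d), Finset.mem_Icc.mpr ⟨hpos, hle⟩, ?_⟩
    have : 2 ^ orderOf (2 : ZMod d) - 1 ≠ 0 := by
      have := Nat.one_lt_two_pow hpos.ne'
      omega
    exact Nat.primeFactors_mono (dvd_two_pow_orderOf_sub_one d) this hp
  have hinj : Set.InjOn Nat.primeFactors (S : Set ℕ) := by
    intro a ha b hb hab
    rw [← Nat.prod_primeFactors_of_squarefree (hS a ha).2.1,
      ← Nat.prod_primeFactors_of_squarefree (hS b hb).2.1, hab]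
  calc ∑ d ∈ S, (1 / (d : ℝ)) = ∑ d ∈ S, ∏ p ∈ d.primeFactors, (1 / (p : ℝ)) := by
        refine Finset.sum_congr rfl fun d hd => ?_
        conv_lhs => rw [← Nat.prod_primeFactors_of_squarefree (hS d hd).2.1]
        simp
    _ = ∑ t ∈ S.image Nat.primeFactors, ∏ p ∈ t, (1 / (p : ℝ)) :=
        (Finset.sum_image (f := fun t : Finset ℕ => ∏ p ∈ t, (1 / (p : ℝ))) hinj).symm
    _ ≤ ∑ t ∈ P.powerset, ∏ p ∈ t, (1 / (p : ℝ)) :=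
        Finset.sum_le_sum_of_subset_of_nonneg (Finset.image_subset_iff.mpr hsub)
          fun t _ _ => Finset.prod_nonneg fun p _ => by positivity
    _ = ∏ p ∈ P, (1 + 1 / (p : ℝ)) := (Finset.prod_one_add P).symm
    _ ≤ ∏ p ∈ P, Real.exp (1 / (p : ℝ)) := by
        refine Finset.prod_le_prod (fun p _ => by positivity) fun p _ => ?_
        rw [add_comm]
        exact Real.add_one_le_exp _
    _ = Real.exp (∑ p ∈ P, 1 / (p : ℝ)) := (Real.exp_sum _ _).symm
    _ ≤ Real.exp (C + 1 + ε * n) := by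
        have h1 := sum_prime_inv_le_of_card_le hPprime (by positivity) hcard
        have h2 := hC (2 * n)
        push_cast at h2
        gcongr
        linarith
    _ = Real.exp (C + 1) * Real.exp (ε * n) := Real.exp_add _ _

/-- The sum of `1 / (d * e₂(d) ^ η)` over odd squarefree `d` converges for every `η > 0`. -/
theorem exists_sum_inv_mul_orderOf_rpow_le {η : ℝ} (hη : 0 < η) :
    ∃ C : ℝ, ∀ S : Finset ℕ, (∀ d ∈ S, Odd d ∧ Squarefree d) →
      ∑ d ∈ S, (1 / (d : ℝ)) * (orderOf (2 : ZMod d) : ℝ) ^ (-η) ≤ C := by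
  have hlog2 : 0 < Real.log 2 := Real.log_pos (by norm_num)
  set ε : ℝ := η * Real.log 2 / 2 with hεdef
  have hε : 0 < ε := by positivity
  obtain ⟨C, hC0, hC⟩ := exists_sum_inv_le_exp_of_orderOf_le hε
  set q : ℝ := Real.exp (-ε) with hq
  have hq1 : q < 1 := Real.exp_lt_one_iff.mpr (by linarith)
  have hq0 : 0 ≤ q := (Real.exp_pos _).le
  refine ⟨C * Real.exp ε * (1 - q)⁻¹, fun S hS => ?_⟩
  set L : ℕ → ℕ := fun d => Nat.log 2 (orderOf (2 : ZMod d)) with hL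
  rw [← Finset.sum_fiberwise_of_maps_to (g := L) (t := S.image L)
    fun d hd => Finset.mem_image_of_mem L hd]
  have hfib : ∀ n ∈ S.image L, ∑ d ∈ S with L d = n,
      (1 / (d : ℝ)) * (orderOf (2 : ZMod d) : ℝ) ^ (-η) ≤ C * Real.exp ε * q ^ n := by
    intro n _
    have h1 : ∀ d ∈ S.filter (fun d => L d = n), (1 / (d : ℝ)) *
        (orderOf (2 : ZMod d) : ℝ) ^ (-η) ≤ (1 / (d : ℝ)) * Real.exp (-(2 * ε) * n) := by
      intro d hd
      rw [Finset.mem_filter] at hd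
      have hpos := orderOf_two_zmod_pos (hS d hd.1).1
      have h2 : (2 : ℝ) ^ n ≤ orderOf (2 : ZMod d) := by
        have := Nat.pow_log_le_self 2 hpos.ne'
        rw [← hd.2]
        exact_mod_cast this
      have h3 : Real.exp (-(2 * ε) * n) = ((2 : ℝ) ^ n) ^ (-η) := by
        rw [Real.rpow_def_of_pos (by positivity), Real.log_pow, hεdef]
        congr 1
        ring
      rw [h3]
      gcongr 1 / (d : ℝ) * ?_
      exact Real.rpow_le_rpow_of_nonpos (by positivity) h2 (by linarith)
    calc _ ≤ ∑ d ∈ S with L d = n, (1 / (d : ℝ)) * Real.exp (-(2 * ε) * n) :=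
          Finset.sum_le_sum h1
      _ = (∑ d ∈ S with L d = n, (1 / (d : ℝ))) * Real.exp (-(2 * ε) * n) := by
          rw [Finset.sum_mul]
      _ ≤ (C * Real.exp (ε * (n + 1 : ℕ))) * Real.exp (-(2 * ε) * n) := by
          gcongr
          refine hC (n + 1) _ fun d hd => ?_
          rw [Finset.mem_filter] at hd
          refine ⟨(hS d hd.1).1, (hS d hd.1).2, ?_⟩
          rw [← hd.2]
          exact (Nat.lt_pow_succ_log_self (by norm_num) _).le
      _ = C * Real.exp ε * q ^ n := by
          rw [hq, ← Real.exp_nat_mul, mul_assoc, mul_assoc, ← Real.exp_add, ← Real.exp_add]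
          congr 2
          push_cast
          ring
  calc _ ≤ ∑ n ∈ S.image L, C * Real.exp ε * q ^ n := Finset.sum_le_sum hfib
    _ = C * Real.exp ε * ∑ n ∈ S.image L, q ^ n := by rw [Finset.mul_sum]
    _ ≤ C * Real.exp ε * (1 - q)⁻¹ := by
        gcongr
        rw [← tsum_geometric_of_lt_one hq0 hq1]
        exact (summable_geometric_of_lt_one hq0 hq1).sum_le_tsum _ fun _ _ => by positivity

/-- The iterated forward difference of `F` with the list of steps `t`. -/
def iterDiff (F : ℝ → ℝ) : List ℕ → ℝ → ℝ
  | [], x => F x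
  | h :: t, x => iterDiff F t (x + h) - iterDiff F t x

/-- The base points in `A` of the combinatorial cubes with steps `t` contained in `A`. -/
def cubeBases (A : Finset ℕ) : List ℕ → Finset ℕ
  | [] => A
  | h :: t => (cubeBases A t).filter fun k => k + h ∈ cubeBases A t

theorem hasDerivAt_iterDiff_rpow (a : ℝ) (t : List ℕ) {x : ℝ} (hx : 0 < x) :
    HasDerivAt (iterDiff (fun u => u ^ a) t) (a * iterDiff (fun u => u ^ (a - 1)) t x) x := by
  induction t generalizing x with
  | nil => exact Real.hasDerivAt_rpow_const (Or.inl hx.ne')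
  | cons h t ih =>
    have h1 : HasDerivAt (fun y => iterDiff (fun u => u ^ a) t (y + h))
        (a * iterDiff (fun u => u ^ (a - 1)) t (x + h)) x :=
      (ih (x := x + h) (by positivity)).comp_add_const x (h : ℝ)
    have h2 := h1.sub (ih hx)
    rw [← mul_sub] at h2
    exact h2

/-- Mean value theorem for iterated differences of a power function. -/
theorem exists_iterDiff_rpow_eq (a : ℝ) (t : List ℕ) (ht : ∀ h ∈ t, 0 < h) {x : ℝ} (hx : 0 < x) :
    ∃ ξ : ℝ, x ≤ ξ ∧ ξ ≤ x + t.sum ∧ iterDiff (fun u => u ^ a) t x =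
      t.prod * (∏ i ∈ Finset.range t.length, (a - i)) * ξ ^ (a - t.length) := by
  induction t generalizing a x with
  | nil => exact ⟨x, le_rfl, by simp, by simp [iterDiff]⟩
  | cons h t ih =>
    have hh : (0 : ℝ) < h := by exact_mod_cast ht h (by simp)
    obtain ⟨y, ⟨hy1, hy2⟩, hy⟩ := exists_hasDerivAt_eq_slope (iterDiff (fun u => u ^ a) t)
      (fun y => a * iterDiff (fun u => u ^ (a - 1)) t y) (lt_add_of_pos_right x hh)
      (fun y hy => (hasDerivAt_iterDiff_rpow a t (hx.trans_le hy.1)).continuousAt.continuousWithinAt)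
      (fun y hy => hasDerivAt_iterDiff_rpow a t (hx.trans hy.1))
    obtain ⟨ξ, h1, h2, h3⟩ := ih (a - 1) (fun k hk => ht k (by simp [hk])) (hx.trans hy1)
    refine ⟨ξ, hy1.le.trans h1, ?_, ?_⟩
    · push_cast [List.sum_cons] at h2 ⊢
      linarith
    · rw [add_sub_cancel_left, eq_div_iff hh.ne', h3] at hy
      rw [iterDiff, ← hy, List.length_cons, Finset.prod_range_succ', List.prod_cons]
      push_cast
      have e1 : ∀ i ∈ Finset.range t.length, a - 1 - (i : ℝ) = a - (i + 1) := fun i _ => by ring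
      rw [Finset.prod_congr rfl e1, show a - 1 - (t.length : ℝ) = a - (t.length + 1) by ring]
      ring

theorem cubeBases_subset (A : Finset ℕ) (t : List ℕ) : cubeBases A t ⊆ A := by
  induction t with
  | nil => exact subset_rfl
  | cons h t ih => exact (Finset.filter_subset _ _).trans ih

theorem add_sum_mem_of_mem_cubeBases {A : Finset ℕ} {t : List ℕ} {k : ℕ}
    (hk : k ∈ cubeBases A t) : k + t.sum ∈ A := by
  induction t generalizing k with
  | nil => simpa [cubeBases] using hk
  | cons h t ih =>
    rw [cubeBases, Finset.mem_filter] at hk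
    have := ih hk.2
    rwa [List.sum_cons, ← add_assoc]

/-- If `F` is within `1` of the progression `l + e * ℤ` on `A`, then its iterated differences
are close to a fixed progression with the same modulus on the cube base points. -/
theorem exists_iterDiff_near_progression {A : Finset ℕ} {F : ℝ → ℝ} {l e : ℝ}
    (hA : ∀ k ∈ A, ∃ m : ℤ, |F k - l - e * m| ≤ 1) (t : List ℕ) :
    ∃ c : ℝ, ∀ k ∈ cubeBases A t, ∃ m : ℤ, |iterDiff F t k - c - e * m| ≤ 2 ^ t.length := by
  induction t with
  | nil => exact ⟨l, by simpa [cubeBases, iterDiff] using hA⟩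
  | cons h t ih =>
    obtain ⟨c, hc⟩ := ih
    refine ⟨0, fun k hk => ?_⟩
    rw [cubeBases, Finset.mem_filter] at hk
    obtain ⟨m, hm⟩ := hc k hk.1
    obtain ⟨m', hm'⟩ := hc (k + h) hk.2
    refine ⟨m' - m, ?_⟩
    rw [iterDiff, List.length_cons, pow_succ]
    push_cast at hm' ⊢
    rw [abs_le] at *
    constructor <;> linarith [hm.1, hm.2, hm'.1, hm'.2]

theorem Finset.card_le_of_sub_le {S : Finset ℤ} {L : ℝ} (hL : 0 ≤ L)
    (h : ∀ a ∈ S, ∀ b ∈ S, ((a - b : ℤ) : ℝ) ≤ L) : (S.card : ℝ) ≤ L + 1 := by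
  rcases S.eq_empty_or_nonempty with rfl | hS
  · simp; linarith
  · have hsub : S ⊆ Finset.Icc (S.min' hS) (S.max' hS) := fun a ha =>
      Finset.mem_Icc.mpr ⟨S.min'_le a ha, S.le_max' a ha⟩
    have h1 := Finset.card_le_card hsub
    rw [Int.card_Icc] at h1
    have h2 := h _ (S.max'_mem hS) _ (S.min'_mem hS)
    have h3 : S.min' hS ≤ S.max' hS := S.min'_le _ (S.max'_mem hS)
    have h4 : (S.card : ℤ) ≤ S.max' hS - S.min' hS + 1 := by omega
    have h5 : (S.card : ℝ) ≤ ((S.max' hS - S.min' hS + 1 : ℤ) : ℝ) := by exact_mod_cast h4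
    push_cast at h2 h5
    linarith

/-- Counting points at which a function growing at rate at least `β` is near a progression. -/
theorem card_le_of_near_progression {B : Finset ℕ} {g : ℕ → ℝ} {β G D c e : ℝ} (hβ : 0 < β)
    (hG : 0 ≤ G) (hD : 0 ≤ D) (he : 0 < e)
    (hgrow : ∀ k ∈ B, ∀ k' ∈ B, k < k' → β * ((k' : ℝ) - k) ≤ g k' - g k)
    (hrange : ∀ k ∈ B, 0 ≤ g k ∧ g k ≤ G)
    (hnear : ∀ k ∈ B, ∃ m : ℤ, |g k - c - e * m| ≤ D) :
    (B.card : ℝ) ≤ (2 * D / β + 1) * ((G + 2 * D) / e + 1) := by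
  choose! m hm using hnear
  have h1 : ((B.image m).card : ℝ) ≤ (G + 2 * D) / e + 1 := by
    refine Finset.card_le_of_sub_le (by positivity) ?_
    intro a ha b hb
    obtain ⟨k, hk, rfl⟩ := Finset.mem_image.mp ha
    obtain ⟨k', hk', rfl⟩ := Finset.mem_image.mp hb
    have e1 := abs_le.mp (hm k hk)
    have e2 := abs_le.mp (hm k' hk')
    have e3 := hrange k hk
    have e4 := hrange k' hk'
    rw [le_div_iff₀ he]
    push_cast
    linarith
  have h2 : ∀ b ∈ B.image m, (B.filter fun k => m k = b).card ≤ ⌊2 * D / β + 1⌋₊ := by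
    intro b _
    refine Nat.le_floor ?_
    rw [← Finset.card_map Nat.castEmbedding (α := ℕ) (β := ℤ)]
    refine Finset.card_le_of_sub_le (by positivity) ?_
    intro a ha a' ha'
    obtain ⟨k, hk, rfl⟩ := Finset.mem_map.mp ha
    obtain ⟨k', hk', rfl⟩ := Finset.mem_map.mp ha'
    rw [Finset.mem_filter] at hk hk'
    simp only [Nat.castEmbedding_apply]
    push_cast
    rcases lt_or_ge k' k with hlt | hge
    · have e0 := hgrow k' hk'.1 k hk.1 hlt
      have e1 := abs_le.mp (hm k hk.1)
      have e2 := abs_le.mp (hm k' hk'.1)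
      rw [hk.2] at e1
      rw [hk'.2] at e2
      rw [le_div_iff₀ hβ]
      linarith
    · have : (k : ℝ) ≤ k' := by exact_mod_cast hge
      have : 0 ≤ 2 * D / β := by positivity
      linarith
  have h3 := Finset.card_le_mul_card_image B _ h2
  calc (B.card : ℝ) ≤ (⌊2 * D / β + 1⌋₊ : ℝ) * ((B.image m).card : ℝ) := by exact_mod_cast h3
    _ ≤ (2 * D / β + 1) * ((G + 2 * D) / e + 1) := by
      gcongr
      exact Nat.floor_le (by positivity)

/-- A set of integers up to `N` either is small or has many pairs with small differences. -/
theorem card_le_add_sum_card_filter_add_mem {A : Finset ℕ} {N H : ℕ} (hA : ∀ k ∈ A, k ≤ N)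
    (hH : 0 < H) :
    A.card ≤ (N / H + 1) + ∑ h ∈ Finset.Icc 1 H, (A.filter fun k => k + h ∈ A).card := by
  classical
  set B := A.filter fun k => ∀ h ∈ Finset.Icc 1 H, k + h ∉ A with hB
  have hBcard : B.card ≤ N / H + 1 := by
    rw [← Finset.card_range (N / H + 1)]
    refine Finset.card_le_card_of_injOn (fun k => k / H) ?_ ?_
    · intro k hk
      have hk' : k ∈ A := (Finset.mem_filter.mp hk).1
      simp only [Finset.coe_range, Set.mem_Iio]
      exact Nat.lt_succ_of_le (Nat.div_le_div_right (hA k hk'))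
    · have key : ∀ a ∈ B, ∀ b ∈ B, a / H = b / H → ¬ a < b := by
        intro a ha b hb hab hlt
        have h1 := Nat.div_add_mod a H
        have h2 := Nat.div_add_mod b H
        have h3 := Nat.mod_lt b hH
        rw [hab] at h1
        refine (Finset.mem_filter.mp ha).2 (b - a) (Finset.mem_Icc.mpr (by omega)) ?_
        rw [Nat.add_sub_cancel' hlt.le]
        exact (Finset.mem_filter.mp hb).1
      intro a ha b hb hab
      have h1 := key a ha b hb hab
      have h2 := key b hb a ha hab.symm
      omega
  have hsub : A ⊆ B ∪ (Finset.Icc 1 H).biUnion fun h => A.filter fun k => k + h ∈ A := by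
    intro k hk
    rw [Finset.mem_union, Finset.mem_biUnion]
    by_cases h : ∀ h ∈ Finset.Icc 1 H, k + h ∉ A
    · exact Or.inl (Finset.mem_filter.mpr ⟨hk, h⟩)
    · push Not at h
      obtain ⟨h, h1, h2⟩ := h
      exact Or.inr ⟨h, h1, Finset.mem_filter.mpr ⟨hk, h2⟩⟩
  calc A.card ≤ _ := Finset.card_le_card hsub
    _ ≤ _ := Finset.card_union_le _ _
    _ ≤ _ := add_le_add hBcard Finset.card_biUnion_le

theorem card_cubeBases_le_of_cons {A : Finset ℕ} {N : ℕ} (hA : ∀ k ∈ A, k ≤ N)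
    {Z C η : ℝ} (hZ : 1 ≤ Z) (hZN : Z ≤ N) (hC : 0 ≤ C) (hη : 0 < η) (hη1 : η ≤ 1) {n : ℕ}
    (hbound : ∀ t : List ℕ, t.length = n + 1 → (∀ h ∈ t, 0 < h) →
      ((cubeBases A t).card : ℝ) ≤ C * t.prod * (N * Z ^ (-η)))
    (t : List ℕ) (ht : t.length = n) (hpos : ∀ h ∈ t, 0 < h) :
    ((cubeBases A t).card : ℝ) ≤ (C + 3) * t.prod * (N * Z ^ (-(η / 3))) := by
  have hZ0 : 0 < Z := by linarith
  have hN0 : (0 : ℝ) < N := by linarith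
  set W : ℝ := Z ^ (η / 3) with hW
  have hW1 : 1 ≤ W := Real.one_le_rpow hZ (by positivity)
  have hWN : W ≤ N := by
    refine le_trans ?_ hZN
    conv_rhs => rw [← Real.rpow_one Z]
    exact Real.rpow_le_rpow_of_exponent_le hZ (by linarith)
  have hW3 : Z ^ (-η) = (W ^ 3)⁻¹ := by
    rw [Real.rpow_neg hZ0.le, hW, ← Real.rpow_natCast, ← Real.rpow_mul hZ0.le]
    congr 2
    push_cast
    ring
  have hWi : Z ^ (-(η / 3)) = W⁻¹ := Real.rpow_neg hZ0.le _
  have hW0 : 0 < W := by linarith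
  set H : ℕ := ⌊W⌋₊ with hH
  have hH0 : 0 < H := Nat.floor_pos.mpr hW1
  have hHW : (H : ℝ) ≤ W := Nat.floor_le hW0.le
  have hWH : W ≤ 2 * H := by
    have h1 := Nat.lt_floor_add_one W
    have h2 : (1 : ℝ) ≤ H := by exact_mod_cast hH0
    linarith
  have hP : (1 : ℝ) ≤ t.prod := by
    have : 0 < t.prod := List.prod_pos hpos
    exact_mod_cast this
  have h1 := card_le_add_sum_card_filter_add_mem
    (fun k hk => hA k (cubeBases_subset A t hk)) hH0
  have h2 : ∀ h ∈ Finset.Icc 1 H, (((cubeBases A t).filter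
      fun k => k + h ∈ cubeBases A t).card : ℝ) ≤ C * (W * t.prod) * (N * (W ^ 3)⁻¹) := by
    intro h hh
    rw [Finset.mem_Icc] at hh
    have h3 := hbound (h :: t) (by simp [ht]) (by
      intro k hk
      rcases List.mem_cons.mp hk with rfl | hk
      · exact hh.1
      · exact hpos k hk)
    rw [cubeBases, hW3] at h3
    refine h3.trans ?_
    rw [List.prod_cons, Nat.cast_mul]
    have : (h : ℝ) ≤ W := le_trans (by exact_mod_cast hh.2) hHW
    gcongr
  have h4 : ((cubeBases A t).card : ℝ) ≤ (N / H + 1) + ∑ h ∈ Finset.Icc 1 H,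
      (((cubeBases A t).filter fun k => k + h ∈ cubeBases A t).card : ℝ) := by
    have h5 : (((N / H : ℕ) : ℝ)) ≤ N / H := Nat.cast_div_le
    have h6 : ((cubeBases A t).card : ℝ) ≤ (((N / H : ℕ) : ℝ) + 1) + ∑ h ∈ Finset.Icc 1 H,
      (((cubeBases A t).filter fun k => k + h ∈ cubeBases A t).card : ℝ) := by exact_mod_cast h1
    linarith
  have h7 : (N : ℝ) / H ≤ 2 * (N * W⁻¹) := by
    rw [div_le_iff₀ (by exact_mod_cast hH0)]
    have : 1 ≤ 2 * H * W⁻¹ := by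
      rw [← div_eq_mul_inv, le_div_iff₀ hW0]
      linarith
    nlinarith
  have h8 : 1 ≤ N * W⁻¹ := by
    rw [← div_eq_mul_inv, le_div_iff₀ hW0]
    linarith
  have h9 := Finset.sum_le_sum h2
  rw [Finset.sum_const, Nat.card_Icc, nsmul_eq_mul, Nat.add_sub_cancel] at h9
  have h10 : (H : ℝ) * (C * (W * t.prod) * (N * (W ^ 3)⁻¹)) ≤ C * t.prod * (N * W⁻¹) := by
    calc _ ≤ W * (C * (W * t.prod) * (N * (W ^ 3)⁻¹)) := by gcongr
      _ = _ := by field_simp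
  rw [hWi]
  have h11 : 3 * (N * W⁻¹) ≤ 3 * t.prod * (N * W⁻¹) := by
    have : 0 ≤ N * W⁻¹ := by positivity
    nlinarith
  calc _ ≤ 2 * (N * W⁻¹) + N * W⁻¹ + C * t.prod * (N * W⁻¹) := by linarith
    _ ≤ _ := by linarith

theorem card_le_of_card_cubeBases_le {A : Finset ℕ} {N : ℕ} (hA : ∀ k ∈ A, k ≤ N)
    {Z C : ℝ} (hZ : 1 ≤ Z) (hZN : Z ≤ N) (hC : 0 ≤ C) {n : ℕ}
    (hbound : ∀ t : List ℕ, t.length = n → (∀ h ∈ t, 0 < h) →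
      ((cubeBases A t).card : ℝ) ≤ C * t.prod * (N * Z⁻¹)) :
    (A.card : ℝ) ≤ (C + 3 * n) * (N * Z ^ (-(1 / 3 ^ n : ℝ))) := by
  have key : ∀ j ≤ n, ∀ t : List ℕ, t.length = n - j → (∀ h ∈ t, 0 < h) →
      ((cubeBases A t).card : ℝ) ≤ (C + 3 * j) * t.prod * (N * Z ^ (-(1 / 3 ^ j : ℝ))) := by
    intro j hj
    induction j with
    | zero => simpa [Real.rpow_neg_one] using hbound
    | succ j ih =>
      intro t ht hpos
      have h1 := card_cubeBases_le_of_cons hA hZ hZN (C := C + 3 * j) (η := 1 / 3 ^ j)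
        (by positivity) (by positivity)
        (by rw [div_le_one (by positivity)]; exact one_le_pow₀ (by norm_num))
        (n := n - (j + 1)) (fun t' ht' => ih (by omega) t' (by omega)) t ht hpos
      rw [div_div, ← pow_succ] at h1
      rwa [Nat.cast_succ, mul_add, mul_one, ← add_assoc]
  simpa [cubeBases] using key n le_rfl [] (by simp)

/-- Upper bound for cubes of dimension `⌊a⌋`, for which the iterated difference of `u ^ a` is
increasing and grows like a power with exponent in `(0, 1)`. -/
theorem exists_card_cubeBases_le {a θ : ℝ} {s : ℕ} (ha : a = s + θ) (hθ0 : 0 < θ) (hθ1 : θ < 1) :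
    ∃ C : ℝ, 0 ≤ C ∧ ∀ (N : ℕ) (A : Finset ℕ) (Z l e : ℝ), 1 ≤ Z → Z ≤ e → Z ≤ (N : ℝ) ^ θ →
      1 ≤ N → (∀ k ∈ A, 0 < k ∧ k ≤ N) →
      (∀ k ∈ A, ∃ m : ℤ, |(k : ℝ) ^ a - l - e * m| ≤ 1) →
      ∀ t : List ℕ, t.length = s → (∀ h ∈ t, 0 < h) →
        ((cubeBases A t).card : ℝ) ≤ C * t.prod * (N * Z⁻¹) := by
  set c₀ : ℝ := ∏ i ∈ Finset.range s, (a - i) with hc₀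
  set c₁ : ℝ := ∏ i ∈ Finset.range (s + 1), (a - i) with hc₁
  have hc₀pos : 0 < c₀ := Finset.prod_pos fun i hi => by
    have : (i : ℝ) < s := by exact_mod_cast Finset.mem_range.mp hi
    linarith
  have hc₁pos : 0 < c₁ := Finset.prod_pos fun i hi => by
    have : (i : ℝ) ≤ s := by exact_mod_cast Nat.lt_succ_iff.mp (Finset.mem_range.mp hi)
    linarith
  refine ⟨(2 * 2 ^ s / c₁ + 1) * (c₀ + 2 * 2 ^ s + 1), by positivity, ?_⟩
  intro N A Z l e hZ hZe hZN hN hA hnear t hts ht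
  have hN1 : (1 : ℝ) ≤ N := by exact_mod_cast hN
  have hN0 : (0 : ℝ) < N := by linarith
  have hZ0 : 0 < Z := by linarith
  have he0 : 0 < e := by linarith
  have hP : (1 : ℝ) ≤ t.prod := by
    have : 0 < t.prod := List.prod_pos ht
    exact_mod_cast this
  obtain ⟨c, hc⟩ := exists_iterDiff_near_progression (F := fun u => u ^ a) hnear t
  have hle : ∀ k ∈ cubeBases A t, (k : ℝ) + t.sum ≤ N := fun k hk => by
    exact_mod_cast (hA _ (add_sum_mem_of_mem_cubeBases hk)).2
  have hpos : ∀ k ∈ cubeBases A t, (0 : ℝ) < k := fun k hk => by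
    exact_mod_cast (hA _ (cubeBases_subset A t hk)).1
  have hmain := card_le_of_near_progression (B := cubeBases A t)
    (g := fun k => iterDiff (fun u => u ^ a) t k) (β := c₁ * (N : ℝ) ^ (θ - 1))
    (G := t.prod * c₀ * (N : ℝ) ^ θ) (D := 2 ^ s) (c := c) (e := e) (by positivity)
    (by positivity) (by positivity) he0 ?_ ?_ (by simpa [hts] using hc)
  · refine hmain.trans ?_
    have hNθ : (N : ℝ) ^ θ * (N : ℝ) ^ (1 - θ) = N := by
      rw [← Real.rpow_add hN0, add_sub_cancel, Real.rpow_one]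
    have h1 : 2 * 2 ^ s / (c₁ * (N : ℝ) ^ (θ - 1)) + 1 ≤
        (2 * 2 ^ s / c₁ + 1) * (N : ℝ) ^ (1 - θ) := by
      have e1 : 2 * 2 ^ s / (c₁ * (N : ℝ) ^ (θ - 1)) = 2 * 2 ^ s / c₁ * (N : ℝ) ^ (1 - θ) := by
        rw [← div_div, div_eq_mul_inv _ ((N : ℝ) ^ (θ - 1)), ← Real.rpow_neg hN0.le, neg_sub]
      have e2 : 1 ≤ (N : ℝ) ^ (1 - θ) := Real.one_le_rpow hN1 (by linarith)
      rw [e1, add_mul, one_mul]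
      linarith
    have h2 : (t.prod * c₀ * (N : ℝ) ^ θ + 2 * 2 ^ s) / e + 1 ≤
        (c₀ + 2 * 2 ^ s + 1) * (t.prod * ((N : ℝ) ^ θ * Z⁻¹)) := by
      have e1 : 1 ≤ (N : ℝ) ^ θ * Z⁻¹ := by
        rw [← div_eq_mul_inv, le_div_iff₀ hZ0]
        linarith
      have e2 : 1 ≤ t.prod * ((N : ℝ) ^ θ * Z⁻¹) := one_le_mul_of_one_le_of_one_le hP e1
      have e3 : e⁻¹ ≤ Z⁻¹ := inv_anti₀ hZ0 hZe
      have e4 : e⁻¹ ≤ 1 := inv_le_one_of_one_le₀ (hZ.trans hZe)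
      have e5 : t.prod * c₀ * (N : ℝ) ^ θ * e⁻¹ ≤ t.prod * c₀ * (N : ℝ) ^ θ * Z⁻¹ := by gcongr
      have e6 : 2 * 2 ^ s * e⁻¹ ≤ 2 * 2 ^ s * (t.prod * ((N : ℝ) ^ θ * Z⁻¹)) := by
        gcongr
        exact e4.trans e2
      rw [div_eq_mul_inv, add_mul, add_mul, add_mul, one_mul]
      linarith
    calc _ ≤ ((2 * 2 ^ s / c₁ + 1) * (N : ℝ) ^ (1 - θ)) *
          ((c₀ + 2 * 2 ^ s + 1) * (t.prod * ((N : ℝ) ^ θ * Z⁻¹))) := by gcongr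
      _ = (2 * 2 ^ s / c₁ + 1) * (c₀ + 2 * 2 ^ s + 1) * t.prod *
          (((N : ℝ) ^ θ * (N : ℝ) ^ (1 - θ)) * Z⁻¹) := by ring
      _ = _ := by rw [hNθ]
  · intro k hk k' hk' hlt
    have hk0 := hpos k hk
    obtain ⟨ξ, h1, h2, h3⟩ := exists_iterDiff_rpow_eq a ((k' - k) :: t) (by
      intro h hh
      rcases List.mem_cons.mp hh with rfl | hh
      · omega
      · exact ht h hh) hk0
    have hcast : ((k' - k : ℕ) : ℝ) = (k' : ℝ) - k := Nat.cast_sub hlt.le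
    rw [iterDiff, List.length_cons, hts, ← hc₁, List.prod_cons, Nat.cast_mul, hcast,
      add_sub_cancel] at h3
    rw [List.sum_cons, Nat.cast_add, hcast, ← add_assoc, add_sub_cancel] at h2
    have hξ : 0 < ξ := hk0.trans_le h1
    have hξN : (N : ℝ) ^ (θ - 1) ≤ ξ ^ (a - (s + 1 : ℕ)) := by
      rw [show a - (s + 1 : ℕ) = θ - 1 by rw [ha]; push_cast; ring]
      exact Real.rpow_le_rpow_of_nonpos hξ (h2.trans (hle k' hk')) (by linarith)
    have hd : 0 < (k' : ℝ) - k := by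
      have : (k : ℝ) < k' := by exact_mod_cast hlt
      linarith
    rw [h3]
    calc c₁ * (N : ℝ) ^ (θ - 1) * ((k' : ℝ) - k)
        = ((k' : ℝ) - k) * 1 * c₁ * (N : ℝ) ^ (θ - 1) := by ring
      _ ≤ _ := by gcongr
  · intro k hk
    have hk0 := hpos k hk
    obtain ⟨ξ, h1, h2, h3⟩ := exists_iterDiff_rpow_eq a t ht hk0
    have hξ : 0 < ξ := hk0.trans_le h1
    rw [hts, ← hc₀, show a - s = θ by rw [ha]; ring] at h3
    simp only [h3]
    refine ⟨by positivity, ?_⟩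
    gcongr
    exact h2.trans (hle k hk)

/-- Power saving in the number of `k ≤ N` with `⌊k ^ r⌋` in a residue class modulo `e`, uniformly
for `e ≤ (2 * N) ^ r`. -/
theorem exists_card_floor_rpow_modEq_le {r : ℝ} (hr : 1 < r) (hri : ∀ m : ℤ, r ≠ m) :
    ∃ C η : ℝ, 0 ≤ C ∧ 0 < η ∧ ∀ N e l : ℕ, 1 ≤ N → 1 ≤ e → (e : ℝ) ≤ (2 * (N : ℝ)) ^ r →
      (((Finset.Icc 1 N).filter fun k : ℕ => ⌊(k : ℝ) ^ r⌋₊ ≡ l [MOD e]).card : ℝ) ≤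
        C * (N * (e : ℝ) ^ (-η)) := by
  set s : ℕ := ⌊r⌋₊ with hs
  set θ : ℝ := r - s with hθ
  have hsr : (s : ℝ) ≤ r := Nat.floor_le (by linarith)
  have hrs : r < s + 1 := Nat.lt_floor_add_one r
  have hθ0 : 0 < θ := by
    have : r ≠ s := by exact_mod_cast hri s
    exact sub_pos.mpr (lt_of_le_of_ne hsr this.symm)
  have hθ1 : θ < 1 := by linarith
  obtain ⟨C, hC, hbound⟩ := exists_card_cubeBases_le (a := r) (θ := θ) (s := s) (by ring) hθ0 hθ1
  set κ : ℝ := 1 / 3 ^ s with hκ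
  have hκ0 : 0 < κ := by positivity
  refine ⟨(C + 3 * s) * 2 ^ κ, θ / r * κ, by positivity, by positivity, ?_⟩
  intro N e l hN he heN
  set A := (Finset.Icc 1 N).filter fun k : ℕ => ⌊(k : ℝ) ^ r⌋₊ ≡ l [MOD e] with hA
  have hAmem : ∀ k ∈ A, 0 < k ∧ k ≤ N := fun k hk =>
    Finset.mem_Icc.mp (Finset.mem_filter.mp hk).1
  have hN1 : (1 : ℝ) ≤ N := by exact_mod_cast hN
  have he1 : (1 : ℝ) ≤ e := by exact_mod_cast he
  have he0 : (0 : ℝ) < e := by linarith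
  set Z : ℝ := min (e : ℝ) ((N : ℝ) ^ θ) with hZ
  have hZ1 : 1 ≤ Z := le_min he1 (Real.one_le_rpow hN1 hθ0.le)
  have hZN : Z ≤ N := (min_le_right _ _).trans (by
    conv_rhs => rw [← Real.rpow_one (N : ℝ)]
    exact Real.rpow_le_rpow_of_exponent_le hN1 hθ1.le)
  have hnear : ∀ k ∈ A, ∃ m : ℤ, |(k : ℝ) ^ r - l - e * m| ≤ 1 := by
    intro k hk
    have hmod := (Finset.mem_filter.mp hk).2
    obtain ⟨m, hm⟩ := (Nat.modEq_iff_dvd.mp hmod.symm)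
    refine ⟨m, ?_⟩
    have hm' : (⌊(k : ℝ) ^ r⌋₊ : ℝ) - l = e * m := by exact_mod_cast hm
    have h1 := Nat.floor_le (a := (k : ℝ) ^ r) (by positivity)
    have h2 := Nat.lt_floor_add_one ((k : ℝ) ^ r)
    rw [← hm', abs_le]
    constructor <;> linarith
  have hcard := card_le_of_card_cubeBases_le (fun k hk => (hAmem k hk).2) hZ1 hZN hC
    (hbound N A Z l e hZ1 (min_le_left _ _) (min_le_right _ _) hN hAmem hnear)
  have hθr : θ / r ≤ 1 := by
    rw [div_le_one (by linarith)]
    linarith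
  have hZe : (e : ℝ) ^ (θ / r) / 2 ≤ Z := by
    refine le_min ?_ ?_
    · have h1 : (e : ℝ) ^ (θ / r) ≤ e := by
        conv_rhs => rw [← Real.rpow_one (e : ℝ)]
        exact Real.rpow_le_rpow_of_exponent_le he1 hθr
      linarith
    · have h1 : (e : ℝ) ^ (θ / r) ≤ ((2 * (N : ℝ)) ^ r) ^ (θ / r) := by gcongr
      rw [← Real.rpow_mul (by positivity), mul_div_cancel₀ θ (by linarith : r ≠ 0),
        Real.mul_rpow (by norm_num) (by positivity)] at h1
      have h2 : (2 : ℝ) ^ θ ≤ 2 := by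
        conv_rhs => rw [← Real.rpow_one (2 : ℝ)]
        exact Real.rpow_le_rpow_of_exponent_le (by norm_num) hθ1.le
      have h3 : (2 : ℝ) ^ θ * (N : ℝ) ^ θ ≤ 2 * (N : ℝ) ^ θ := by gcongr
      linarith
  have hsave : Z ^ (-κ) ≤ 2 ^ κ * (e : ℝ) ^ (-(θ / r * κ)) := by
    calc Z ^ (-κ) ≤ ((e : ℝ) ^ (θ / r) / 2) ^ (-κ) :=
          Real.rpow_le_rpow_of_nonpos (by positivity) hZe (by linarith)
      _ = 2 ^ κ * (e : ℝ) ^ (-(θ / r * κ)) := by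
          rw [Real.div_rpow (by positivity) (by norm_num), ← Real.rpow_mul he0.le,
            Real.rpow_neg (by norm_num : (0 : ℝ) ≤ 2), div_inv_eq_mul, mul_comm, mul_neg]
  calc (A.card : ℝ) ≤ (C + 3 * s) * (N * Z ^ (-κ)) := hcard
    _ ≤ (C + 3 * s) * (N * (2 ^ κ * (e : ℝ) ^ (-(θ / r * κ)))) := by gcongr
    _ = _ := by ring

/-- for every choice of residues `ℓ_d` with `0 ≤ ℓ_d ≤ e₂(d) − 1`,
`Σ_d (1/d) · #{k : 0 < k, k ≤ (log(2x)/log 2)^{1/r}, ⌊k^r⌋ ≡ ℓ_d (mod e₂(d))}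
  ≪_r (log x)^{1/r}`, the sum being over odd squarefree `d ≤ x` with all prime
factors `< log x` and `e₂(d) ≤ (log x)^{1−1/r} log log x`, where `e₂(d)` is the
multiplicative order of `2` mod `d`. -/
theorem sum_congruence_count_upper (r : ℝ) (hr : 1 < r) (hri : ∀ m : ℤ, r ≠ m) :
    ∃ C x₀ : ℝ, ∀ x : ℝ, x₀ ≤ x → ∀ l : ℕ → ℕ,
      (∀ d : ℕ, Odd d → l d ≤ orderOf (2 : ZMod d) - 1) →
      ∑ d ∈ (Finset.Icc 1 ⌊x⌋₊).filter (fun d : ℕ => Odd d ∧ Squarefree d ∧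
          (∀ p ∈ d.primeFactors, (p : ℝ) < Real.log x) ∧
          ((orderOf (2 : ZMod d) : ℕ) : ℝ) ≤
            (Real.log x) ^ (1 - 1 / r) * Real.log (Real.log x)),
        (1 / (d : ℝ)) *
          (({k : ℕ | 0 < k ∧ (k : ℝ) ≤ (Real.log (2 * x) / Real.log 2) ^ (1 / r) ∧
            ⌊(k : ℝ) ^ r⌋₊ ≡ l d [MOD orderOf (2 : ZMod d)]} : Set ℕ).ncard : ℝ)
      ≤ C * (Real.log x) ^ (1 / r) := by
  obtain ⟨C, η, hC, hη, hcount⟩ := exists_card_floor_rpow_modEq_le hr hri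
  obtain ⟨R, hR⟩ := exists_sum_inv_mul_orderOf_rpow_le hη
  have hr0 : 0 < r := by linarith
  have hev : ∀ᶠ x : ℝ in Filter.atTop,
      2 ≤ x ∧ 1 ≤ Real.log x ∧ Real.log (Real.log x) ≤ Real.log x ^ (1 / r) := by
    have h1 := ((isLittleO_log_rpow_atTop (r := 1 / r) (by positivity)).bound one_pos)
    have h2 := Real.tendsto_log_atTop.eventually h1
    filter_upwards [h2, Filter.eventually_ge_atTop (2 : ℝ),
      Real.tendsto_log_atTop.eventually_ge_atTop (1 : ℝ)] with x hx hx2 hx1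
    refine ⟨hx2, hx1, ?_⟩
    rw [one_mul, Real.norm_of_nonneg (Real.rpow_nonneg (by linarith) _)] at hx
    exact (Real.le_norm_self _).trans hx
  obtain ⟨x₀, hx₀⟩ := Filter.eventually_atTop.mp hev
  refine ⟨C * R * 4 ^ (1 / r), x₀, fun x hx l _ => ?_⟩
  obtain ⟨hx2, hlog1, hloglog⟩ := hx₀ x hx
  set L := Real.log x with hL
  have hL0 : 0 < L := by linarith
  set K : ℝ := (Real.log (2 * x) / Real.log 2) ^ (1 / r) with hK
  have hlog2 : 0 < Real.log 2 := Real.log_pos (by norm_num)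
  have hlog2x : Real.log (2 * x) = Real.log 2 + L := Real.log_mul (by norm_num) (by linarith)
  have hbase1 : L ≤ Real.log (2 * x) / Real.log 2 := by
    rw [hlog2x, le_div_iff₀ hlog2]
    nlinarith [Real.log_two_lt_d9]
  have hbase2 : Real.log (2 * x) / Real.log 2 ≤ 4 * L := by
    rw [hlog2x, div_le_iff₀ hlog2]
    nlinarith [Real.log_two_gt_d9, Real.log_two_lt_d9]
  have hK1 : 1 ≤ K := Real.one_le_rpow (hlog1.trans hbase1) (by positivity)
  have hKL : K ≤ 4 ^ (1 / r) * L ^ (1 / r) := by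
    rw [← Real.mul_rpow (by norm_num) hL0.le]
    exact Real.rpow_le_rpow (by linarith) hbase2 (by positivity)
  have hLK : L ≤ K ^ r := by
    rw [hK, ← Real.rpow_mul (by linarith), one_div_mul_cancel hr0.ne', Real.rpow_one]
    exact hbase1
  set N : ℕ := ⌊K⌋₊ with hN
  have hN1 : 1 ≤ N := Nat.le_floor (by exact_mod_cast hK1)
  have hNK : (N : ℝ) ≤ K := Nat.floor_le (by linarith)
  have hK2N : K ≤ 2 * N := by
    have h1 := Nat.lt_floor_add_one K
    have h2 : (1 : ℝ) ≤ N := by exact_mod_cast hN1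
    linarith
  set S := (Finset.Icc 1 ⌊x⌋₊).filter (fun d : ℕ => Odd d ∧ Squarefree d ∧
          (∀ p ∈ d.primeFactors, (p : ℝ) < L) ∧
          ((orderOf (2 : ZMod d) : ℕ) : ℝ) ≤ L ^ (1 - 1 / r) * Real.log L) with hS
  have hRnonneg : 0 ≤ R := by simpa using hR ∅ (by simp)
  have hterm : ∀ d ∈ S, (1 / (d : ℝ)) * (({k : ℕ | 0 < k ∧ (k : ℝ) ≤ K ∧
      ⌊(k : ℝ) ^ r⌋₊ ≡ l d [MOD orderOf (2 : ZMod d)]} : Set ℕ).ncard : ℝ) ≤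
      C * N * ((1 / (d : ℝ)) * (orderOf (2 : ZMod d) : ℝ) ^ (-η)) := by
    intro d hd
    obtain ⟨-, hodd, -, -, hord⟩ := Finset.mem_filter.mp hd
    have hset : {k : ℕ | 0 < k ∧ (k : ℝ) ≤ K ∧
        ⌊(k : ℝ) ^ r⌋₊ ≡ l d [MOD orderOf (2 : ZMod d)]} =
        ((Finset.Icc 1 N).filter fun k : ℕ =>
          ⌊(k : ℝ) ^ r⌋₊ ≡ l d [MOD orderOf (2 : ZMod d)] : Finset ℕ) := by
      ext k
      simp only [Set.mem_ofPred_eq, Finset.coe_filter, Finset.mem_Icc, hN,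
        Nat.le_floor_iff (by linarith : 0 ≤ K), Nat.succ_le_iff, and_assoc]
    have hordL : ((orderOf (2 : ZMod d) : ℕ) : ℝ) ≤ (2 * (N : ℝ)) ^ r := by
      calc _ ≤ L ^ (1 - 1 / r) * Real.log L := hord
        _ ≤ L ^ (1 - 1 / r) * L ^ (1 / r) := by gcongr
        _ = L := by rw [← Real.rpow_add hL0, sub_add_cancel, Real.rpow_one]
        _ ≤ K ^ r := hLK
        _ ≤ (2 * (N : ℝ)) ^ r := by gcongr
    have h1 := hcount N (orderOf (2 : ZMod d)) (l d) hN1 (orderOf_two_zmod_pos hodd) hordL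
    rw [hset, Set.ncard_coe_finset]
    calc _ ≤ 1 / (d : ℝ) * (C * (N * (orderOf (2 : ZMod d) : ℝ) ^ (-η))) := by gcongr
      _ = _ := by ring
  calc _ ≤ ∑ d ∈ S, C * N * ((1 / (d : ℝ)) * (orderOf (2 : ZMod d) : ℝ) ^ (-η)) :=
        Finset.sum_le_sum hterm
    _ = C * N * ∑ d ∈ S, (1 / (d : ℝ)) * (orderOf (2 : ZMod d) : ℝ) ^ (-η) := by
        rw [Finset.mul_sum]
    _ ≤ C * N * R := by
        gcongr
        refine hR S fun d hd => ?_
        obtain ⟨-, hodd, hsq, -⟩ := Finset.mem_filter.mp hd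
        exact ⟨hodd, hsq⟩
    _ ≤ C * (4 ^ (1 / r) * L ^ (1 / r)) * R := by
        gcongr
        exact hNK.trans hKL
    _ = C * R * 4 ^ (1 / r) * L ^ (1 / r) := by ring
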